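/- Let ε = ±1 and let v : ℝ × ℝⁿ → ℂ be a smooth solution of the cubic Gross–Pitaevskii equation i∂_t v + Δ_x v = ε(|v|² - 1)v such that v - 1 is exponentially localized (there exist C, γ > 0 with |∂^α (v(t,x) - 1)| ≤ C e^{-γ|x|} for all (t,x) and all space-time derivatives ∂^α of order at most 2) and v is time-periodic with some period T > 0. If either (i) n = 1 and ε·(E_nz[v] - (ε/2) M_nz[v]) ≤ 0, or (ii) n = 2 and E_nz[v] ≠ 0, then |v(t,x)| = 1 for all (t,x). (In particular, no breather with nonzero background exists in these regimes.) -/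

import Mathlib

open MeasureTheory Real Complex Function

/-- Partial derivative in the `j`-th coordinate direction. -/
noncomputable def pd {n : ℕ} (f : EuclideanSpace ℝ (Fin n) → ℂ) (j : Fin n)
    (x : EuclideanSpace ℝ (Fin n)) : ℂ :=
  fderiv ℝ f x (EuclideanSpace.single j 1)

/-- Spatial Laplacian. -/
noncomputable def lap {n : ℕ} (f : EuclideanSpace ℝ (Fin n) → ℂ)
    (x : EuclideanSpace ℝ (Fin n)) : ℂ :=
  ∑ j, pd (fun y => pd f j y) j x

/-- Mass with nonzero background (at `t = 0`), `M_nz[v] = ∫ (|v|² - 1) dx`. -/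
noncomputable def massNZ {n : ℕ} (v : ℝ → EuclideanSpace ℝ (Fin n) → ℂ) : ℝ :=
  ∫ x, (‖v 0 x‖ ^ 2 - 1)

/-- Energy with nonzero background for the cubic case `p = 2` (at `t = 0`),
`E_nz[v] = ∫ (|∇v|² - (2ε/4)(1 - |v|⁴)) dx`. -/
noncomputable def energyNZcubic {n : ℕ} (ε : ℝ)
    (v : ℝ → EuclideanSpace ℝ (Fin n) → ℂ) : ℝ :=
  ∫ x, ((∑ j, ‖pd (v 0) j x‖ ^ 2) - (2 * ε / (2 + 2)) * (1 - ‖v 0 x‖ ^ 4))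

section RapidDecay

open Finset

variable {n : ℕ} {V W : Type*} [NormedAddCommGroup V] [NormedAddCommGroup W]

/-- Decay in space, uniformly in time, faster than any inverse power. -/
def RapidDecay (F : ℝ × EuclideanSpace ℝ (Fin n) → V) : Prop :=
  ∀ m : ℕ, ∃ C, ∀ p, (1 + ‖p.2‖) ^ m * ‖F p‖ ≤ C

/-- Polynomial growth in space, uniformly in time. -/
def SlowGrowth (F : ℝ × EuclideanSpace ℝ (Fin n) → V) : Prop :=
  ∃ (m : ℕ) (C : ℝ), 0 ≤ C ∧ ∀ p, ‖F p‖ ≤ C * (1 + ‖p.2‖) ^ m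

/-- The unit space-time vector in the time direction. -/
def timeDir (n : ℕ) : ℝ × EuclideanSpace ℝ (Fin n) := (1, 0)

/-- The unit space-time vectors in the coordinate directions of space. -/
noncomputable def spaceDir (k : Fin n) : ℝ × EuclideanSpace ℝ (Fin n) :=
  (0, EuclideanSpace.single k 1)

/-- The coordinate functions of space. -/
def coordFun (k : Fin n) (p : ℝ × EuclideanSpace ℝ (Fin n)) : ℝ := p.2 k

lemma RapidDecay.of_exp {F : ℝ × EuclideanSpace ℝ (Fin n) → V} {C γ : ℝ} (hγ : 0 < γ)
    (h : ∀ p, ‖F p‖ ≤ C * Real.exp (-γ * ‖p.2‖)) : RapidDecay F := by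
  intro m
  refine ⟨m.factorial / γ ^ m * Real.exp γ * C, fun p => ?_⟩
  have h1 := Real.pow_div_factorial_le_exp (γ * (1 + ‖p.2‖)) (by positivity) m
  have h2 : (1 + ‖p.2‖) ^ m ≤ m.factorial / γ ^ m * Real.exp (γ * (1 + ‖p.2‖)) := by
    rw [mul_pow, div_le_iff₀ (by positivity)] at h1
    rw [div_mul_eq_mul_div, le_div_iff₀ (by positivity)]
    linarith
  calc (1 + ‖p.2‖) ^ m * ‖F p‖
      ≤ (m.factorial / γ ^ m * Real.exp (γ * (1 + ‖p.2‖))) * (C * Real.exp (-γ * ‖p.2‖)) := by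
        gcongr; exact h p
    _ = m.factorial / γ ^ m * C * (Real.exp (γ * (1 + ‖p.2‖)) * Real.exp (-γ * ‖p.2‖)) := by ring
    _ = m.factorial / γ ^ m * Real.exp γ * C := by
        rw [← Real.exp_add]; ring_nf

lemma RapidDecay.mono {F : ℝ × EuclideanSpace ℝ (Fin n) → V}
    {G : ℝ × EuclideanSpace ℝ (Fin n) → W} (hF : RapidDecay F)
    (h : ∀ p, ‖G p‖ ≤ ‖F p‖) : RapidDecay G := by
  intro m
  obtain ⟨C, hC⟩ := hF m
  exact ⟨C, fun p => le_trans (by gcongr; exact h p) (hC p)⟩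

lemma RapidDecay.add {F G : ℝ × EuclideanSpace ℝ (Fin n) → V} (hF : RapidDecay F)
    (hG : RapidDecay G) : RapidDecay (F + G) := by
  intro m
  obtain ⟨C, hC⟩ := hF m
  obtain ⟨D, hD⟩ := hG m
  refine ⟨C + D, fun p => ?_⟩
  calc (1 + ‖p.2‖) ^ m * ‖F p + G p‖ ≤ (1 + ‖p.2‖) ^ m * (‖F p‖ + ‖G p‖) := by
        gcongr; exact norm_add_le _ _
    _ ≤ C + D := by rw [mul_add]; exact add_le_add (hC p) (hD p)

lemma SlowGrowth.of_bound {F : ℝ × EuclideanSpace ℝ (Fin n) → V} (C : ℝ)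
    (h : ∀ p, ‖F p‖ ≤ C) : SlowGrowth F :=
  ⟨0, C, (norm_nonneg _).trans (h 0), by simpa using h⟩

lemma RapidDecay.slowGrowth {F : ℝ × EuclideanSpace ℝ (Fin n) → V} (hF : RapidDecay F) :
    SlowGrowth F := by
  obtain ⟨C, hC⟩ := hF 0
  exact .of_bound C (by simpa using hC)

lemma RapidDecay.exists_integrable_bound {F : ℝ × EuclideanSpace ℝ (Fin n) → V}
    (hF : RapidDecay F) :
    ∃ B : EuclideanSpace ℝ (Fin n) → ℝ, Integrable B ∧ ∀ t x, ‖F (t, x)‖ ≤ B x := by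
  obtain ⟨C, hC⟩ := hF (n + 1)
  refine ⟨fun x => C * (1 + ‖x‖) ^ (-((n + 1 : ℕ) : ℝ)),
    (integrable_one_add_norm (by simp)).const_mul C, fun t x => ?_⟩
  have h := hC (t, x)
  beta_reduce
  rw [Real.rpow_neg (by positivity), Real.rpow_natCast, ← div_eq_mul_inv,
    le_div_iff₀ (by positivity)]
  linarith

lemma RapidDecay.integrable {F : ℝ × EuclideanSpace ℝ (Fin n) → V}
    (hF : RapidDecay F) (hc : Continuous F) (t : ℝ) : Integrable fun x => F (t, x) := by
  obtain ⟨B, hB, hFB⟩ := hF.exists_integrable_bound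
  exact hB.mono' (by fun_prop) (.of_forall fun x => hFB t x)

variable [NormedSpace ℝ V] [NormedSpace ℝ W]

/-- Continuously differentiable functions decaying rapidly together with their derivative. -/
structure RapidC1 (F : ℝ × EuclideanSpace ℝ (Fin n) → V) : Prop where
  contDiff : ContDiff ℝ 1 F
  decay : RapidDecay F
  decay_fderiv : RapidDecay (fderiv ℝ F)

/-- The directional derivative in space-time. -/
noncomputable def dd (u : ℝ × EuclideanSpace ℝ (Fin n))
    (F : ℝ × EuclideanSpace ℝ (Fin n) → V) (p : ℝ × EuclideanSpace ℝ (Fin n)) : V :=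
  fderiv ℝ F p u

/-- The Euler operator `x · ∇`. -/
noncomputable def euler (F : ℝ × EuclideanSpace ℝ (Fin n) → ℝ) :
    ℝ × EuclideanSpace ℝ (Fin n) → ℝ :=
  ∑ k, coordFun k * dd (spaceDir k) F

lemma SlowGrowth.smul_rapidDecay {F : ℝ × EuclideanSpace ℝ (Fin n) → ℝ}
    {G : ℝ × EuclideanSpace ℝ (Fin n) → V} (hF : SlowGrowth F) (hG : RapidDecay G) :
    RapidDecay (fun p => F p • G p) := by
  intro m
  obtain ⟨k, C, hC0, hC⟩ := hF
  obtain ⟨D, hD⟩ := hG (m + k)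
  refine ⟨C * D, fun p => ?_⟩
  rw [norm_smul]
  calc (1 + ‖p.2‖) ^ m * (‖F p‖ * ‖G p‖)
      ≤ (1 + ‖p.2‖) ^ m * ((C * (1 + ‖p.2‖) ^ k) * ‖G p‖) := by gcongr; exact hC p
    _ = C * ((1 + ‖p.2‖) ^ (m + k) * ‖G p‖) := by rw [pow_add]; ring
    _ ≤ C * D := by gcongr; exact hD p

lemma RapidDecay.smul_slowGrowth {F : ℝ × EuclideanSpace ℝ (Fin n) → ℝ}
    {G : ℝ × EuclideanSpace ℝ (Fin n) → V} (hF : RapidDecay F) (hG : SlowGrowth G) :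
    RapidDecay (fun p => F p • G p) := by
  intro m
  obtain ⟨k, C, hC0, hC⟩ := hG
  obtain ⟨D, hD⟩ := hF (m + k)
  refine ⟨C * D, fun p => ?_⟩
  rw [norm_smul]
  calc (1 + ‖p.2‖) ^ m * (‖F p‖ * ‖G p‖)
      ≤ (1 + ‖p.2‖) ^ m * (‖F p‖ * (C * (1 + ‖p.2‖) ^ k)) := by gcongr; exact hC p
    _ = C * ((1 + ‖p.2‖) ^ (m + k) * ‖F p‖) := by rw [pow_add]; ring
    _ ≤ C * D := by gcongr; exact hD p

lemma RapidC1.differentiable {F : ℝ × EuclideanSpace ℝ (Fin n) → V} (hF : RapidC1 F) :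
    Differentiable ℝ F := hF.contDiff.differentiable one_ne_zero

lemma RapidC1.clm_comp {F : ℝ × EuclideanSpace ℝ (Fin n) → V} (hF : RapidC1 F)
    (L : V →L[ℝ] W) : RapidC1 (fun p => L (F p)) where
  contDiff := L.contDiff.comp hF.contDiff
  decay := by
    refine ((SlowGrowth.of_bound ‖L‖ (F := fun _ => ‖L‖) (by simp)).smul_rapidDecay
      hF.decay).mono fun p => ?_
    simpa [norm_smul] using L.le_opNorm (F p)
  decay_fderiv := by
    refine ((SlowGrowth.of_bound ‖L‖ (F := fun _ => ‖L‖) (by simp)).smul_rapidDecay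
      hF.decay_fderiv).mono fun p => ?_
    rw [show fderiv ℝ (fun p => L (F p)) p = L.comp (fderiv ℝ F p) from
      (L.hasFDerivAt.comp p (hF.differentiable p).hasFDerivAt).fderiv]
    simpa [norm_smul] using L.opNorm_comp_le (fderiv ℝ F p)

lemma RapidC1.add {F G : ℝ × EuclideanSpace ℝ (Fin n) → V} (hF : RapidC1 F)
    (hG : RapidC1 G) : RapidC1 (F + G) where
  contDiff := hF.contDiff.add hG.contDiff
  decay := hF.decay.add hG.decay
  decay_fderiv := by
    convert hF.decay_fderiv.add hG.decay_fderiv using 1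
    funext p
    exact fderiv_add (hF.differentiable p) (hG.differentiable p)

lemma RapidC1.slow_mul {F G : ℝ × EuclideanSpace ℝ (Fin n) → ℝ} (hFc : ContDiff ℝ 1 F)
    (hFs : SlowGrowth F) (hFs' : SlowGrowth (fderiv ℝ F)) (hG : RapidC1 G) :
    RapidC1 (F * G) where
  contDiff := hFc.mul hG.contDiff
  decay := hFs.smul_rapidDecay hG.decay
  decay_fderiv := by
    convert (hFs.smul_rapidDecay hG.decay_fderiv).add (hG.decay.smul_slowGrowth hFs') using 1
    funext p
    exact fderiv_mul (hFc.differentiable one_ne_zero p) (hG.differentiable p)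

lemma RapidC1.mul {F G : ℝ × EuclideanSpace ℝ (Fin n) → ℝ} (hF : RapidC1 F)
    (hG : RapidC1 G) : RapidC1 (F * G) :=
  .slow_mul hF.contDiff hF.decay.slowGrowth hF.decay_fderiv.slowGrowth hG

lemma RapidC1.const_smul {F : ℝ × EuclideanSpace ℝ (Fin n) → ℝ} (hF : RapidC1 F) (c : ℝ) :
    RapidC1 (c • F) :=
  hF.clm_comp (c • ContinuousLinearMap.id ℝ ℝ)

lemma RapidC1.sub {F G : ℝ × EuclideanSpace ℝ (Fin n) → ℝ} (hF : RapidC1 F)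
    (hG : RapidC1 G) : RapidC1 (F - G) := by
  have h := hF.add (hG.const_smul (-1))
  rwa [neg_one_smul, ← sub_eq_add_neg] at h

lemma RapidC1.zero : RapidC1 (0 : ℝ × EuclideanSpace ℝ (Fin n) → V) where
  contDiff := contDiff_const
  decay m := ⟨0, by simp⟩
  decay_fderiv m := ⟨0, by simp⟩

lemma RapidC1.sum {ι : Type*} {s : Finset ι} {F : ι → ℝ × EuclideanSpace ℝ (Fin n) → V}
    (hF : ∀ i, RapidC1 (F i)) : RapidC1 (∑ i ∈ s, F i) :=
  Finset.sum_induction _ _ (fun _ _ => RapidC1.add) .zero fun i _ => hF i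

lemma hasFDerivAt_coordFun (k : Fin n) (p : ℝ × EuclideanSpace ℝ (Fin n)) :
    HasFDerivAt (coordFun k)
      ((EuclideanSpace.proj k : EuclideanSpace ℝ (Fin n) →L[ℝ] ℝ).comp
        (ContinuousLinearMap.snd ℝ ℝ (EuclideanSpace ℝ (Fin n)))) p :=
  ContinuousLinearMap.hasFDerivAt
    ((EuclideanSpace.proj k : EuclideanSpace ℝ (Fin n) →L[ℝ] ℝ).comp
        (ContinuousLinearMap.snd ℝ ℝ (EuclideanSpace ℝ (Fin n))))

lemma contDiff_coordFun (k : Fin n) : ContDiff ℝ 1 (coordFun k) :=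
  ContinuousLinearMap.contDiff
    ((EuclideanSpace.proj k : EuclideanSpace ℝ (Fin n) →L[ℝ] ℝ).comp
        (ContinuousLinearMap.snd ℝ ℝ (EuclideanSpace ℝ (Fin n))))

lemma differentiable_coordFun (k : Fin n) : Differentiable ℝ (coordFun k) :=
  (contDiff_coordFun k).differentiable one_ne_zero

lemma RapidC1.coordFun_mul {F : ℝ × EuclideanSpace ℝ (Fin n) → ℝ} (hF : RapidC1 F)
    (k : Fin n) : RapidC1 (coordFun k * F) := by
  refine .slow_mul (contDiff_coordFun k) ⟨1, 1, zero_le_one, fun p => ?_⟩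
    (.of_bound ‖(EuclideanSpace.proj k : EuclideanSpace ℝ (Fin n) →L[ℝ] ℝ).comp
        (ContinuousLinearMap.snd ℝ ℝ (EuclideanSpace ℝ (Fin n)))‖ fun p => ?_) hF
  · have := PiLp.norm_apply_le p.2 k
    simp only [coordFun, one_mul, pow_one]
    linarith
  · rw [(hasFDerivAt_coordFun k p).fderiv]

lemma RapidC1.euler {F : ℝ × EuclideanSpace ℝ (Fin n) → ℝ}
    (hF : ∀ u, RapidC1 (dd u F)) : RapidC1 (euler F) :=
  .sum fun k => (hF (spaceDir k)).coordFun_mul k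

section Calculus

variable {F G : ℝ × EuclideanSpace ℝ (Fin n) → ℝ} (u : ℝ × EuclideanSpace ℝ (Fin n))

lemma dd_add (hF : Differentiable ℝ F) (hG : Differentiable ℝ G) :
    dd u (F + G) = dd u F + dd u G := by
  funext p
  simp [dd, fderiv_add (hF p) (hG p)]

lemma dd_sub (hF : Differentiable ℝ F) (hG : Differentiable ℝ G) :
    dd u (F - G) = dd u F - dd u G := by
  funext p
  simp [dd, fderiv_sub (hF p) (hG p)]

lemma dd_mul (hF : Differentiable ℝ F) (hG : Differentiable ℝ G) :
    dd u (F * G) = F * dd u G + G * dd u F := by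
  funext p
  simp [dd, fderiv_mul (hF p) (hG p)]

lemma dd_smul (c : ℝ) (hF : Differentiable ℝ F) : dd u (c • F) = c • dd u F := by
  funext p
  simp [dd, fderiv_const_smul (hF p)]

lemma dd_sum {ι : Type*} {s : Finset ι} {H : ι → ℝ × EuclideanSpace ℝ (Fin n) → ℝ}
    (hH : ∀ i, Differentiable ℝ (H i)) : dd u (∑ i ∈ s, H i) = ∑ i ∈ s, dd u (H i) := by
  funext p
  simp [dd, fderiv_sum (fun i _ => hH i p)]

lemma dd_timeDir_coordFun (k : Fin n) : dd (timeDir n) (coordFun k) = 0 := by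
  funext p
  simp [dd, (hasFDerivAt_coordFun k p).fderiv, timeDir]

lemma dd_spaceDir_coordFun (j k : Fin n) :
    dd (spaceDir j) (coordFun k) = if j = k then 1 else 0 := by
  funext p
  simp only [dd, (hasFDerivAt_coordFun k p).fderiv, spaceDir]
  by_cases h : j = k
  · simp [h]
  · simp [h, Ne.symm h]

lemma dd_comm (hF : ContDiff ℝ 2 F) (u w : ℝ × EuclideanSpace ℝ (Fin n)) :
    dd u (dd w F) = dd w (dd u F) := by
  funext p
  have hd : Differentiable ℝ (fderiv ℝ F) :=
    (hF.fderiv_right (m := 1) (by norm_num)).differentiable one_ne_zero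
  have h (w u) : dd u (dd w F) p = fderiv ℝ (fderiv ℝ F) p u w := by
    have h := ((hd p).hasFDerivAt.clm_apply (hasFDerivAt_const w p)).fderiv
    change fderiv ℝ (fun q => fderiv ℝ F q w) p u = _
    simp [h]
  rw [h, h]
  exact (hF.contDiffAt.isSymmSndFDerivAt (by simp)).eq u w

lemma euler_add (hF : Differentiable ℝ F) (hG : Differentiable ℝ G) :
    euler (F + G) = euler F + euler G := by
  simp [euler, dd_add _ hF hG, mul_add, sum_add_distrib]

lemma euler_sub (hF : Differentiable ℝ F) (hG : Differentiable ℝ G) :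
    euler (F - G) = euler F - euler G := by
  simp [euler, dd_sub _ hF hG, mul_sub, sum_sub_distrib]

lemma euler_mul (hF : Differentiable ℝ F) (hG : Differentiable ℝ G) :
    euler (F * G) = F * euler G + G * euler F := by
  simp only [euler, dd_mul _ hF hG, mul_sum, ← sum_add_distrib]
  exact sum_congr rfl fun k _ => by ring

lemma euler_smul (c : ℝ) (hF : Differentiable ℝ F) : euler (c • F) = c • euler F := by
  simp [euler, dd_smul _ c hF, smul_sum]

lemma euler_sum {ι : Type*} {s : Finset ι} {H : ι → ℝ × EuclideanSpace ℝ (Fin n) → ℝ}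
    (hH : ∀ i, Differentiable ℝ (H i)) : euler (∑ i ∈ s, H i) = ∑ i ∈ s, euler (H i) := by
  simp only [euler, dd_sum _ hH, mul_sum]
  exact sum_comm

lemma dd_timeDir_euler (hF : ContDiff ℝ 2 F) (hd : ∀ u, Differentiable ℝ (dd u F)) :
    dd (timeDir n) (euler F) = euler (dd (timeDir n) F) := by
  rw [euler, dd_sum _ fun k => (differentiable_coordFun k).mul (hd _)]
  simp [dd_mul _ (differentiable_coordFun _) (hd _), dd_timeDir_coordFun, euler,
    dd_comm hF (timeDir n)]

lemma dd_spaceDir_euler (hF : ContDiff ℝ 2 F) (hd : ∀ u, Differentiable ℝ (dd u F))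
    (j : Fin n) :
    dd (spaceDir j) (euler F) = dd (spaceDir j) F + euler (dd (spaceDir j) F) := by
  rw [euler, dd_sum _ fun k => (differentiable_coordFun k).mul (hd _)]
  simp [dd_mul _ (differentiable_coordFun _) (hd _), dd_spaceDir_coordFun, euler,
    dd_comm hF (spaceDir j), sum_add_distrib, add_comm]

lemma sum_dd_coordFun_mul (hF : Differentiable ℝ F) :
    ∑ k, dd (spaceDir k) (coordFun k * F) = (n : ℝ) • F + euler F := by
  simp only [dd_mul _ (differentiable_coordFun _) hF, dd_spaceDir_coordFun, euler,
    sum_add_distrib, if_true, mul_one, sum_const, card_univ, Fintype.card_fin]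
  rw [Nat.cast_smul_eq_nsmul, add_comm]

end Calculus

section Integration

lemma RapidC1.integrable {F : ℝ × EuclideanSpace ℝ (Fin n) → V} (hF : RapidC1 F) (t : ℝ) :
    Integrable fun x => F (t, x) :=
  hF.decay.integrable hF.contDiff.continuous t

lemma RapidC1.decay_dd {F : ℝ × EuclideanSpace ℝ (Fin n) → ℝ} (hF : RapidC1 F)
    (u : ℝ × EuclideanSpace ℝ (Fin n)) : RapidDecay (dd u F) := by
  refine ((SlowGrowth.of_bound ‖u‖ (F := fun _ => ‖u‖) (by simp)).smul_rapidDecay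
      hF.decay_fderiv).mono fun p => ?_
  simpa [norm_smul, dd, mul_comm] using (fderiv ℝ F p).le_opNorm u

lemma RapidC1.continuous_dd {F : ℝ × EuclideanSpace ℝ (Fin n) → ℝ} (hF : RapidC1 F)
    (u : ℝ × EuclideanSpace ℝ (Fin n)) : Continuous (dd u F) :=
  (hF.contDiff.continuous_fderiv one_ne_zero).clm_apply continuous_const

lemma fderiv_slice {F : ℝ × EuclideanSpace ℝ (Fin n) → V} (hF : Differentiable ℝ F)
    (t : ℝ) (x y : EuclideanSpace ℝ (Fin n)) :
    fderiv ℝ (fun z => F (t, z)) x y = dd (0, y) F (t, x) := by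
  have h := ((hF (t, x)).hasFDerivAt.comp x (hasFDerivAt_prodMk_right t x)).fderiv
  rw [Function.comp_def] at h
  simp [h, dd]

lemma hasDerivAt_slice {F : ℝ × EuclideanSpace ℝ (Fin n) → V} (hF : Differentiable ℝ F)
    (t : ℝ) (x : EuclideanSpace ℝ (Fin n)) :
    HasDerivAt (fun s => F (s, x)) (dd (timeDir n) F (t, x)) t := by
  have h := ((hF (t, x)).hasFDerivAt.comp t (hasFDerivAt_prodMk_left t x)).hasDerivAt
  simpa [dd, timeDir, Function.comp_def] using h

lemma RapidC1.integral_dd_spaceDir {F : ℝ × EuclideanSpace ℝ (Fin n) → ℝ} (hF : RapidC1 F)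
    (t : ℝ) (k : Fin n) : ∫ x, dd (spaceDir k) F (t, x) = 0 := by
  have hd : Differentiable ℝ fun x => F (t, x) :=
    hF.differentiable.comp (by fun_prop : Differentiable ℝ fun x => (t, x))
  have h := integral_mul_fderiv_eq_neg_fderiv_mul_of_integrable (μ := volume)
    (f := fun _ : EuclideanSpace ℝ (Fin n) => (1 : ℝ)) (g := fun x => F (t, x))
    (v := EuclideanSpace.single k 1) (by simp)
    (by
      simp only [one_mul, fderiv_slice hF.differentiable]
      exact (hF.decay_dd _).integrable (hF.continuous_dd _) t)
    (by simpa using hF.integrable t) (by simp) (fun x _ => hd x)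
  simpa [fderiv_slice hF.differentiable, spaceDir] using h

/-- The integrated form of a local balance law `∂ₜ F = ∑ₖ ∂ₖ Hₖ + S`. -/
lemma hasDerivAt_integral_of_balance {F S : ℝ × EuclideanSpace ℝ (Fin n) → ℝ}
    {H : Fin n → ℝ × EuclideanSpace ℝ (Fin n) → ℝ} (hF : RapidC1 F) (hS : RapidC1 S)
    (hH : ∀ k, RapidC1 (H k))
    (h : dd (timeDir n) F = ∑ k, dd (spaceDir k) (H k) + S) (t : ℝ) :
    HasDerivAt (fun s => ∫ x, F (s, x)) (∫ x, S (t, x)) t := by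
  obtain ⟨B, hB, hFB⟩ := (hF.decay_dd (timeDir n)).exists_integrable_bound
  have key := (hasDerivAt_integral_of_dominated_loc_of_deriv_le (μ := volume)
    (F := fun s x => F (s, x)) (F' := fun s x => dd (timeDir n) F (s, x)) (s := Set.univ)
    (x₀ := t) (bound := B) Filter.univ_mem
    (.of_forall fun s => (hF.integrable s).aestronglyMeasurable) (hF.integrable t)
    ((hF.decay_dd _).integrable (hF.continuous_dd _) t).aestronglyMeasurable
    (.of_forall fun x s _ => hFB s x) hB
    (.of_forall fun x s _ => hasDerivAt_slice hF.differentiable s x)).2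
  suffices hi : ∫ x, S (t, x) = ∫ x, dd (timeDir n) F (t, x) by rwa [hi]
  simp only [h, Pi.add_apply, Finset.sum_apply]
  have hi (k : Fin n) : Integrable fun x => dd (spaceDir k) (H k) (t, x) :=
    ((hH k).decay_dd _).integrable ((hH k).continuous_dd _) t
  rw [integral_add (integrable_finsetSum _ fun k _ => hi k) (hS.integrable t),
    integral_finsetSum _ fun k _ => hi k]
  rw [Finset.sum_eq_zero fun k _ => (hH k).integral_dd_spaceDir t k, zero_add]

end Integration

end RapidDecay

section BalanceLaws

open Finset

variable {n : ℕ} {ε : ℝ} {α β : ℝ × EuclideanSpace ℝ (Fin n) → ℝ}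

/-- The density `|v|² - 1` for `v = 1 + α + iβ`. -/
noncomputable def massDensity (α β : ℝ × EuclideanSpace ℝ (Fin n) → ℝ) :
    ℝ × EuclideanSpace ℝ (Fin n) → ℝ :=
  α * α + (2 : ℝ) • α + β * β

/-- The density `|∇v|²` for `v = 1 + α + iβ`. -/
noncomputable def gradDensity (α β : ℝ × EuclideanSpace ℝ (Fin n) → ℝ) :
    ℝ × EuclideanSpace ℝ (Fin n) → ℝ :=
  ∑ k, (dd (spaceDir k) α * dd (spaceDir k) α + dd (spaceDir k) β * dd (spaceDir k) β)

/-- The density `|∇v|² - (ε/2)(1 - |v|⁴)` for `v = 1 + α + iβ`. -/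
noncomputable def energyDensity (ε : ℝ) (α β : ℝ × EuclideanSpace ℝ (Fin n) → ℝ) :
    ℝ × EuclideanSpace ℝ (Fin n) → ℝ :=
  gradDensity α β
    + (ε / 2) • (massDensity α β * massDensity α β + (2 : ℝ) • massDensity α β)

/-- The virial density `Im (v̄ x · ∇v)` for `v = 1 + α + iβ`. -/
noncomputable def virialDensity (α β : ℝ × EuclideanSpace ℝ (Fin n) → ℝ) :
    ℝ × EuclideanSpace ℝ (Fin n) → ℝ :=
  euler β + α * euler β - β * euler α

/-- The source `2|∇v|² + (nε/2)(|v|⁴ - 1)` in the virial identity, for `v = 1 + α + iβ`. -/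
noncomputable def virialSource (ε : ℝ) (α β : ℝ × EuclideanSpace ℝ (Fin n) → ℝ) :
    ℝ × EuclideanSpace ℝ (Fin n) → ℝ :=
  (2 : ℝ) • gradDensity α β
    + (n * ε / 2) • (massDensity α β * massDensity α β + (2 : ℝ) • massDensity α β)

/-- The density flux `2 Im (v̄ ∂ₖv)` with reversed sign, for `v = 1 + α + iβ`. -/
noncomputable def massFlux (α β : ℝ × EuclideanSpace ℝ (Fin n) → ℝ) (k : Fin n) :
    ℝ × EuclideanSpace ℝ (Fin n) → ℝ :=
  (-2 : ℝ) • (dd (spaceDir k) β + α * dd (spaceDir k) β - β * dd (spaceDir k) α)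

/-- The Laplacian in the space variables. -/
noncomputable def spaceLap (F : ℝ × EuclideanSpace ℝ (Fin n) → ℝ) :
    ℝ × EuclideanSpace ℝ (Fin n) → ℝ :=
  ∑ k, dd (spaceDir k) (dd (spaceDir k) F)

/-- `1 + α + iβ` is a localized solution of the cubic Gross–Pitaevskii equation. -/
structure IsLocalizedGP (ε : ℝ) (α β : ℝ × EuclideanSpace ℝ (Fin n) → ℝ) : Prop where
  contDiff_re : ContDiff ℝ 2 α
  contDiff_im : ContDiff ℝ 2 β
  re : RapidC1 α
  im : RapidC1 β
  dd_re : ∀ u, RapidC1 (dd u α)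
  dd_im : ∀ u, RapidC1 (dd u β)
  time_re : dd (timeDir n) α = ε • (massDensity α β * β) - spaceLap β
  time_im : dd (timeDir n) β = spaceLap α - ε • (massDensity α β * (1 + α))

namespace IsLocalizedGP

lemma rapidC1_massDensity (h : IsLocalizedGP ε α β) : RapidC1 (massDensity α β) :=
  ((h.re.mul h.re).add (h.re.const_smul 2)).add (h.im.mul h.im)

lemma rapidC1_gradDensity (h : IsLocalizedGP ε α β) : RapidC1 (gradDensity α β) :=
  .sum fun _ => ((h.dd_re _).mul (h.dd_re _)).add ((h.dd_im _).mul (h.dd_im _))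

lemma rapidC1_pressure (h : IsLocalizedGP ε α β) :
    RapidC1 (massDensity α β * massDensity α β + (2 : ℝ) • massDensity α β) :=
  (h.rapidC1_massDensity.mul h.rapidC1_massDensity).add (h.rapidC1_massDensity.const_smul 2)

lemma rapidC1_energyDensity (h : IsLocalizedGP ε α β) : RapidC1 (energyDensity ε α β) :=
  h.rapidC1_gradDensity.add (h.rapidC1_pressure.const_smul _)

lemma rapidC1_virialSource (h : IsLocalizedGP ε α β) : RapidC1 (virialSource ε α β) :=
  (h.rapidC1_gradDensity.const_smul 2).add (h.rapidC1_pressure.const_smul _)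

lemma rapidC1_virialDensity (h : IsLocalizedGP ε α β) : RapidC1 (virialDensity α β) :=
  ((RapidC1.euler h.dd_im).add (h.re.mul (RapidC1.euler h.dd_im))).sub
    (h.im.mul (RapidC1.euler h.dd_re))

lemma rapidC1_massFlux (h : IsLocalizedGP ε α β) (k : Fin n) : RapidC1 (massFlux α β k) :=
  (((h.dd_im _).add (h.re.mul (h.dd_im _))).sub (h.im.mul (h.dd_re _))).const_smul _

lemma dd_massDensity (h : IsLocalizedGP ε α β) (u : ℝ × EuclideanSpace ℝ (Fin n)) :
    dd u (massDensity α β) = (2 : ℝ) • (dd u α + α * dd u α + β * dd u β) := by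
  have ha := h.re.differentiable
  have hb := h.im.differentiable
  rw [massDensity, dd_add u ((ha.mul ha).add (ha.const_smul 2)) (hb.mul hb),
    dd_add u (ha.mul ha) (ha.const_smul 2), dd_mul u ha ha, dd_mul u hb hb, dd_smul u 2 ha]
  funext p
  simp
  ring

lemma sum_dd_massFlux (h : IsLocalizedGP ε α β) :
    ∑ k, dd (spaceDir k) (massFlux α β k) = dd (timeDir n) (massDensity α β) := by
  have ha := h.re.differentiable
  have hb := h.im.differentiable
  have hA u := (h.dd_re u).differentiable
  have hB u := (h.dd_im u).differentiable
  have key : ∑ k, dd (spaceDir k) (massFlux α β k)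
      = (-2 : ℝ) • (spaceLap β + α * spaceLap β - β * spaceLap α) := by
    simp only [spaceLap, mul_sum, ← sum_add_distrib, ← sum_sub_distrib, smul_sum]
    refine sum_congr rfl fun k _ => ?_
    rw [massFlux, dd_smul _ _ (((hB _).add (ha.mul (hB _))).sub (hb.mul (hA _))),
      dd_sub _ ((hB _).add (ha.mul (hB _))) (hb.mul (hA _)), dd_add _ (hB _) (ha.mul (hB _)),
      dd_mul _ ha (hB _), dd_mul _ hb (hA _)]
    funext p
    simp
    ring
  rw [key, h.dd_massDensity, h.time_re, h.time_im]
  funext p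
  simp
  ring

lemma hasDerivAt_mass (h : IsLocalizedGP ε α β) (t : ℝ) :
    HasDerivAt (fun s => ∫ x, massDensity α β (s, x)) 0 t := by
  simpa using hasDerivAt_integral_of_balance h.rapidC1_massDensity .zero h.rapidC1_massFlux
    (by rw [h.sum_dd_massFlux, add_zero]) t

lemma hasDerivAt_energy (h : IsLocalizedGP ε α β) (t : ℝ) :
    HasDerivAt (fun s => ∫ x, energyDensity ε α β (s, x)) 0 t := by
  have ha := h.re.differentiable
  have hb := h.im.differentiable
  have hA u := (h.dd_re u).differentiable
  have hB u := (h.dd_im u).differentiable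
  have hm := h.rapidC1_massDensity.differentiable
  let K (k : Fin n) : ℝ × EuclideanSpace ℝ (Fin n) → ℝ :=
    dd (spaceDir k) α * dd (timeDir n) α + dd (spaceDir k) β * dd (timeDir n) β
  have hK (k) : RapidC1 (K k) :=
    ((h.dd_re _).mul (h.dd_re _)).add ((h.dd_im _).mul (h.dd_im _))
  have key : dd (timeDir n) (gradDensity α β) + (2 : ℝ) • (spaceLap α * dd (timeDir n) α
      + spaceLap β * dd (timeDir n) β) = ∑ k, (2 : ℝ) • dd (spaceDir k) (K k) := by
    rw [gradDensity, dd_sum _ fun k => ((hA _).mul (hA _)).add ((hB _).mul (hB _))]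
    simp only [spaceLap, sum_mul, ← sum_add_distrib, smul_sum]
    refine sum_congr rfl fun k _ => ?_
    simp only [K]
    rw [dd_add _ ((hA _).mul (hA _)) ((hB _).mul (hB _)),
      dd_add _ ((hA _).mul (hA _)) ((hB _).mul (hB _)), dd_mul _ (hA _) (hA _),
      dd_mul _ (hB _) (hB _), dd_mul _ (hA _) (hA _), dd_mul _ (hB _) (hB _),
      dd_comm h.contDiff_re (timeDir n), dd_comm h.contDiff_im (timeDir n)]
    funext p
    simp
    ring
  have hbal : dd (timeDir n) (energyDensity ε α β)
      = ∑ k, dd (spaceDir k) ((2 : ℝ) • K k + ε • massFlux α β k) + 0 := by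
    have hsum : ∑ k, dd (spaceDir k) ((2 : ℝ) • K k + ε • massFlux α β k)
        = ∑ k, (2 : ℝ) • dd (spaceDir k) (K k) + ε • dd (timeDir n) (massDensity α β) := by
      rw [← h.sum_dd_massFlux, smul_sum, ← sum_add_distrib]
      refine sum_congr rfl fun k _ => ?_
      rw [dd_add _ ((hK k).const_smul 2).differentiable
        ((h.rapidC1_massFlux k).const_smul ε).differentiable,
        dd_smul _ _ (hK k).differentiable, dd_smul _ _ (h.rapidC1_massFlux k).differentiable]
    rw [hsum, ← key, energyDensity, dd_add _ h.rapidC1_gradDensity.differentiable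
      (h.rapidC1_pressure.const_smul _).differentiable,
      dd_smul _ _ h.rapidC1_pressure.differentiable, dd_add _ (hm.mul hm) (hm.const_smul 2),
      dd_mul _ hm hm, dd_smul _ _ hm, h.dd_massDensity]
    funext p
    have h1 := congrFun h.time_re p
    have h2 := congrFun h.time_im p
    simp at h1 h2 ⊢
    linear_combination (2 * dd (timeDir n) α p) * h2 - (2 * dd (timeDir n) β p) * h1
  simpa using hasDerivAt_integral_of_balance h.rapidC1_energyDensity .zero
    (fun k => ((hK k).const_smul 2).add ((h.rapidC1_massFlux k).const_smul ε)) hbal t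

lemma hasDerivAt_virial (h : IsLocalizedGP ε α β) (t : ℝ) :
    HasDerivAt (fun s => ∫ x, virialDensity α β (s, x)) (∫ x, virialSource ε α β (t, x)) t := by
  have ha := h.re.differentiable
  have hb := h.im.differentiable
  have hA u := (h.dd_re u).differentiable
  have hB u := (h.dd_im u).differentiable
  have hr := RapidC1.euler h.dd_re
  have hs := RapidC1.euler h.dd_im
  have hm := h.rapidC1_massDensity
  have hT := ((h.dd_im (timeDir n)).add (h.re.mul (h.dd_im (timeDir n)))).sub
    (h.im.mul (h.dd_re (timeDir n)))
  have hG := h.rapidC1_gradDensity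
  have hP := (hm.mul hm).const_smul (ε / 2)
  let Q := (dd (timeDir n) β + α * dd (timeDir n) β - β * dd (timeDir n) α)
    + gradDensity α β + (ε / 2) • (massDensity α β * massDensity α β)
  have hQ : RapidC1 Q := (hT.add hG).add hP
  let R (k : Fin n) := dd (spaceDir k) α + α * dd (spaceDir k) α + β * dd (spaceDir k) β
  have hR (k) : RapidC1 (R k) :=
    ((h.dd_re _).add (h.re.mul (h.dd_re _))).add (h.im.mul (h.dd_im _))
  let Z (k : Fin n) := euler α * dd (spaceDir k) α + euler β * dd (spaceDir k) β
  have hZ (k) : RapidC1 (Z k) := (hr.mul (h.dd_re _)).add (hs.mul (h.dd_im _))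
  let X := ∑ k, (dd (spaceDir k) α * euler (dd (spaceDir k) α)
    + dd (spaceDir k) β * euler (dd (spaceDir k) β))
  have hsumR : ∑ k, dd (spaceDir k) (R k)
      = spaceLap α + α * spaceLap α + β * spaceLap β + gradDensity α β := by
    simp only [spaceLap, gradDensity, mul_sum, ← sum_add_distrib, R]
    refine sum_congr rfl fun k _ => ?_
    rw [dd_add _ ((hA _).add (ha.mul (hA _))) (hb.mul (hB _)), dd_add _ (hA _) (ha.mul (hA _)),
      dd_mul _ ha (hA _), dd_mul _ hb (hB _)]
    ring
  have hsumZ : ∑ k, dd (spaceDir k) (Z k)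
      = euler α * spaceLap α + euler β * spaceLap β + gradDensity α β + X := by
    simp only [spaceLap, gradDensity, mul_sum, ← sum_add_distrib, Z, X]
    refine sum_congr rfl fun k _ => ?_
    rw [dd_add _ (hr.differentiable.mul (hA _)) (hs.differentiable.mul (hB _)),
      dd_mul _ hr.differentiable (hA _), dd_mul _ hs.differentiable (hB _),
      dd_spaceDir_euler h.contDiff_re hA, dd_spaceDir_euler h.contDiff_im hB]
    ring
  have heG : euler (gradDensity α β) = (2 : ℝ) • X := by
    rw [gradDensity, euler_sum fun k => ((hA _).mul (hA _)).add ((hB _).mul (hB _))]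
    simp only [X, smul_sum]
    refine sum_congr rfl fun k _ => ?_
    rw [euler_add ((hA _).mul (hA _)) ((hB _).mul (hB _)), euler_mul (hA _) (hA _),
      euler_mul (hB _) (hB _)]
    funext p
    simp
    ring
  have hem : euler (massDensity α β) = (2 : ℝ) • (euler α + α * euler α + β * euler β) := by
    rw [massDensity, euler_add ((ha.mul ha).add (ha.const_smul 2)) (hb.mul hb),
      euler_add (ha.mul ha) (ha.const_smul 2), euler_mul ha ha, euler_mul hb hb, euler_smul 2 ha]
    funext p
    simp
    ring
  have heQ : euler Q = (euler (dd (timeDir n) β) + (α * euler (dd (timeDir n) β)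
      + dd (timeDir n) β * euler α) - (β * euler (dd (timeDir n) α)
      + dd (timeDir n) α * euler β)) + (2 : ℝ) • X
      + ε • (massDensity α β * euler (massDensity α β)) := by
    simp only [Q]
    rw [euler_add (hT.add hG).differentiable hP.differentiable,
      euler_add hT.differentiable hG.differentiable, heG,
      euler_sub ((hB _).add (ha.mul (hB _))) (hb.mul (hA _)),
      euler_add (hB _) (ha.mul (hB _)), euler_mul ha (hB _), euler_mul hb (hA _),
      euler_smul _ (hm.mul hm).differentiable, euler_mul hm.differentiable hm.differentiable]
    funext p
    simp
    ring
  have hbal : dd (timeDir n) (virialDensity α β)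
      = ∑ k, dd (spaceDir k) (coordFun k * Q - (n : ℝ) • R k - (2 : ℝ) • Z k)
        + virialSource ε α β := by
    have hsum : ∑ k, dd (spaceDir k) (coordFun k * Q - (n : ℝ) • R k - (2 : ℝ) • Z k)
        = ((n : ℝ) • Q + euler Q) - (n : ℝ) • ∑ k, dd (spaceDir k) (R k)
          - (2 : ℝ) • ∑ k, dd (spaceDir k) (Z k) := by
      rw [← sum_dd_coordFun_mul hQ.differentiable, smul_sum, smul_sum, ← sum_sub_distrib,
        ← sum_sub_distrib]
      refine sum_congr rfl fun k _ => ?_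
      rw [dd_sub _ ((hQ.coordFun_mul k).sub ((hR k).const_smul _)).differentiable
          ((hZ k).const_smul _).differentiable,
        dd_sub _ (hQ.coordFun_mul k).differentiable ((hR k).const_smul _).differentiable,
        dd_smul _ _ (hR k).differentiable, dd_smul _ _ (hZ k).differentiable]
    rw [hsum, hsumR, hsumZ, heQ, hem, virialDensity,
      dd_sub _ (hs.differentiable.add (ha.mul hs.differentiable)) (hb.mul hr.differentiable),
      dd_add _ hs.differentiable (ha.mul hs.differentiable), dd_mul _ ha hs.differentiable,
      dd_mul _ hb hr.differentiable, dd_timeDir_euler h.contDiff_re hA,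
      dd_timeDir_euler h.contDiff_im hB]
    funext p
    have h1 := congrFun h.time_re p
    have h2 := congrFun h.time_im p
    have h3 : massDensity α β p = α p * α p + 2 * α p + β p * β p := by simp [massDensity]
    simp [virialSource, Q] at h1 h2 ⊢
    linear_combination (2 * euler β p + n * β p) * h1 - (2 * euler α p + n * (1 + α p)) * h2
      - n * ε * massDensity α β p * h3
  exact hasDerivAt_integral_of_balance h.rapidC1_virialDensity h.rapidC1_virialSource
    (fun k => ((hQ.coordFun_mul k).sub ((hR k).const_smul _)).sub ((hZ k).const_smul _)) hbal t

end IsLocalizedGP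

end BalanceLaws

section Solutions

open Finset

variable {n : ℕ}

lemma dd_clm_comp {V W : Type*} [NormedAddCommGroup V] [NormedSpace ℝ V]
    [NormedAddCommGroup W] [NormedSpace ℝ W] {F : ℝ × EuclideanSpace ℝ (Fin n) → V}
    (hF : Differentiable ℝ F) (L : V →L[ℝ] W) (u : ℝ × EuclideanSpace ℝ (Fin n)) :
    dd u (fun p => L (F p)) = fun p => L (dd u F p) := by
  funext p
  have h := (L.hasFDerivAt.comp p (hF p).hasFDerivAt).fderiv
  rw [Function.comp_def] at h
  simp [dd, h]

lemma dd_add_right_eq {V : Type*} [NormedAddCommGroup V] [NormedSpace ℝ V]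
    {F : ℝ × EuclideanSpace ℝ (Fin n) → V} {w : ℝ × EuclideanSpace ℝ (Fin n)}
    (hF : ∀ p, F (p + w) = F p) (u p : ℝ × EuclideanSpace ℝ (Fin n)) :
    dd u F (p + w) = dd u F p := by
  simp only [dd, ← fderiv_comp_add_right, hF]

lemma virialDensity_periodic {α β : ℝ × EuclideanSpace ℝ (Fin n) → ℝ} {T : ℝ}
    (hα : ∀ p, α (p + (T, 0)) = α p) (hβ : ∀ p, β (p + (T, 0)) = β p)
    (p : ℝ × EuclideanSpace ℝ (Fin n)) :
    virialDensity α β (p + (T, 0)) = virialDensity α β p := by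
  simp [virialDensity, euler, hα, hβ, dd_add_right_eq hα, dd_add_right_eq hβ, coordFun]

variable {v : ℝ → EuclideanSpace ℝ (Fin n) → ℂ}

lemma pd_eq_dd (hv : Differentiable ℝ fun p : ℝ × EuclideanSpace ℝ (Fin n) => v p.1 p.2 - 1)
    (t : ℝ) (k : Fin n) (x : EuclideanSpace ℝ (Fin n)) :
    pd (v t) k x = dd (spaceDir k) (fun p => v p.1 p.2 - 1) (t, x) := by
  have h := fderiv_slice hv t x (EuclideanSpace.single k 1)
  rwa [fderiv_sub_const] at h

lemma lap_eq_sum_dd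
    (hv : ContDiff ℝ 2 fun p : ℝ × EuclideanSpace ℝ (Fin n) => v p.1 p.2 - 1)
    (t : ℝ) (x : EuclideanSpace ℝ (Fin n)) :
    lap (v t) x
      = ∑ k, dd (spaceDir k) (dd (spaceDir k) fun p => v p.1 p.2 - 1) (t, x) := by
  refine sum_congr rfl fun k _ => ?_
  simp only [pd_eq_dd (hv.differentiable two_ne_zero)]
  have hd : Differentiable ℝ (dd (spaceDir k) fun p => v p.1 p.2 - 1) := fun p =>
    (((hv.fderiv_right (m := 1) (by norm_num)).differentiable one_ne_zero) p).clm_apply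
      (differentiableAt_const _)
  exact fderiv_slice hd t x _

lemma norm_sq_sub_one_eq (t : ℝ) (x : EuclideanSpace ℝ (Fin n)) :
    ‖v t x‖ ^ 2 - 1 = massDensity (fun p => (v p.1 p.2 - 1).re)
      (fun p => (v p.1 p.2 - 1).im) (t, x) := by
  rw [Complex.sq_norm, Complex.normSq_apply]
  simp [massDensity]
  ring

lemma isLocalizedGP_of_solution {ε : ℝ}
    (hsmooth : ContDiff ℝ (⊤ : ℕ∞) (Function.uncurry v))
    (heq : ∀ (t : ℝ) (x : EuclideanSpace ℝ (Fin n)),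
      Complex.I * deriv (fun s => v s x) t + lap (v t) x
        = (ε : ℂ) * ((‖v t x‖ ^ 2 - 1 : ℝ) : ℂ) * v t x)
    (hloc : ∃ C > 0, ∃ γ > 0, ∀ k : ℕ, k ≤ 2 → ∀ (t : ℝ) (x : EuclideanSpace ℝ (Fin n)),
      ‖iteratedFDeriv ℝ k (fun p : ℝ × EuclideanSpace ℝ (Fin n) => v p.1 p.2 - 1) (t, x)‖
        ≤ C * Real.exp (-γ * ‖x‖)) :
    IsLocalizedGP ε (fun p => (v p.1 p.2 - 1).re) (fun p => (v p.1 p.2 - 1).im) := by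
  set g : ℝ × EuclideanSpace ℝ (Fin n) → ℂ := fun p => v p.1 p.2 - 1 with hg
  have hgs : ContDiff ℝ (⊤ : ℕ∞) g := hsmooth.sub contDiff_const
  have hg2 : ContDiff ℝ 2 g := mod_cast contDiff_infty.1 hgs 2
  have hg1 : ContDiff ℝ 1 (fderiv ℝ g) := hg2.fderiv_right (by norm_num)
  have hgd : Differentiable ℝ g := hg2.differentiable two_ne_zero
  obtain ⟨C, -, γ, hγ, hC⟩ := hloc
  have hdecay (k : ℕ) (hk : k ≤ 2) : RapidDecay (iteratedFDeriv ℝ k g) :=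
    .of_exp hγ fun p => hC k hk p.1 p.2
  have hdecay1 : RapidDecay (fderiv ℝ g) :=
    (hdecay 1 (by norm_num)).mono fun p => by rw [norm_iteratedFDeriv_one]
  have R0 : RapidC1 g :=
    ⟨hg2.of_le (by norm_num), (hdecay 0 (by norm_num)).mono fun p => by
      rw [norm_iteratedFDeriv_zero], hdecay1⟩
  have R1 : RapidC1 (fderiv ℝ g) :=
    ⟨hg1, hdecay1, (hdecay 2 le_rfl).mono fun p => by
      rw [← norm_iteratedFDeriv_one, norm_iteratedFDeriv_fderiv]⟩
  have Rd (u) : RapidC1 (dd u g) := R1.clm_comp (ContinuousLinearMap.apply ℝ ℂ u)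
  have hre (u) : dd u (fun p => (g p).re) = fun p => (dd u g p).re :=
    dd_clm_comp hgd Complex.reCLM u
  have him (u) : dd u (fun p => (g p).im) = fun p => (dd u g p).im :=
    dd_clm_comp hgd Complex.imCLM u
  have hre2 (u w) : dd u (fun p => (dd w g p).re) = fun p => (dd u (dd w g) p).re :=
    dd_clm_comp (Rd w).differentiable Complex.reCLM u
  have him2 (u w) : dd u (fun p => (dd w g p).im) = fun p => (dd u (dd w g) p).im :=
    dd_clm_comp (Rd w).differentiable Complex.imCLM u
  have main (p : ℝ × EuclideanSpace ℝ (Fin n)) :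
      Complex.I * dd (timeDir n) g p + ∑ k, dd (spaceDir k) (dd (spaceDir k) g) p
        = (ε : ℂ) * (massDensity (fun p => (g p).re) (fun p => (g p).im) p : ℂ) * (g p + 1) := by
    have ht : deriv (fun s => v s p.2) p.1 = dd (timeDir n) g p := by
      rw [← (hasDerivAt_slice hgd p.1 p.2).deriv, hg, deriv_sub_const]
    rw [← ht, ← lap_eq_sum_dd hg2 p.1 p.2, heq p.1 p.2, norm_sq_sub_one_eq]
    simp [hg]
  change IsLocalizedGP ε (fun p => (g p).re) (fun p => (g p).im)
  clear_value g
  refine ⟨Complex.reCLM.contDiff.comp hg2, Complex.imCLM.contDiff.comp hg2,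
    R0.clm_comp Complex.reCLM, R0.clm_comp Complex.imCLM,
    fun u => hre u ▸ (Rd u).clm_comp Complex.reCLM,
    fun u => him u ▸ (Rd u).clm_comp Complex.imCLM, ?_, ?_⟩
  · funext p
    have h := congrArg Complex.im (main p)
    simp [spaceLap, hre, him, him2] at h ⊢
    linear_combination h
  · funext p
    have h := congrArg Complex.re (main p)
    simp [spaceLap, hre, him, hre2] at h ⊢
    linear_combination -h

lemma massNZ_eq (v : ℝ → EuclideanSpace ℝ (Fin n) → ℂ) :
    massNZ v = ∫ x, massDensity (fun p => (v p.1 p.2 - 1).re)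
      (fun p => (v p.1 p.2 - 1).im) (0, x) := by
  simp only [massNZ, norm_sq_sub_one_eq]

lemma energyNZcubic_eq
    (hv : Differentiable ℝ fun p : ℝ × EuclideanSpace ℝ (Fin n) => v p.1 p.2 - 1) (ε : ℝ) :
    energyNZcubic ε v = ∫ x, energyDensity ε (fun p => (v p.1 p.2 - 1).re)
      (fun p => (v p.1 p.2 - 1).im) (0, x) := by
  refine integral_congr_ae (.of_forall fun x => ?_)
  have hre (u) := dd_clm_comp hv Complex.reCLM u
  have him (u) := dd_clm_comp hv Complex.imCLM u
  simp only [Complex.reCLM_apply, Complex.imCLM_apply] at hre him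
  have hgrad : ∑ k, ‖pd (v 0) k x‖ ^ 2 = gradDensity (fun p => (v p.1 p.2 - 1).re)
      (fun p => (v p.1 p.2 - 1).im) (0, x) := by
    simp only [gradDensity, Finset.sum_apply, Pi.add_apply, Pi.mul_apply, hre, him, pd_eq_dd hv,
      Complex.sq_norm, Complex.normSq_apply]
  simp only [energyDensity, hgrad, Pi.add_apply, Pi.mul_apply, Pi.smul_apply, smul_eq_mul,
    ← norm_sq_sub_one_eq]
  ring

lemma Monotone.eq_of_periodic {f : ℝ → ℝ} {T : ℝ} (hf : Monotone f)
    (hper : Function.Periodic f T) (hT : 0 < T) (s t : ℝ) : f s = f t := by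
  have key (s t : ℝ) : f s ≤ f t := by
    obtain ⟨k, hk⟩ := Archimedean.arch (s - t) hT
    calc f s ≤ f (t + k • T) := hf (by linarith)
      _ = f t := by simpa using hper.nsmul k t
  exact le_antisymm (key s t) (key t s)

end Solutions

/-- **Nonexistence of breathers with nonzero background for the cubic
Gross–Pitaevskii equation.**  A smooth time-periodic solution of
`i ∂ₜ v + Δ v = ε(|v|² - 1) v` with `v - 1` exponentially localized, lying in the
regimes (i) `n = 1`, `ε(E_nz - (ε/2) M_nz) ≤ 0` or (ii) `n = 2`, `E_nz ≠ 0`,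
satisfies `|v| ≡ 1`. -/
theorem no_cubic_GP_breather (n : ℕ) (ε : ℝ) (hε : ε = 1 ∨ ε = -1)
    (v : ℝ → EuclideanSpace ℝ (Fin n) → ℂ)
    (hsmooth : ContDiff ℝ (⊤ : ℕ∞) (Function.uncurry v))
    (heq : ∀ (t : ℝ) (x : EuclideanSpace ℝ (Fin n)),
      Complex.I * deriv (fun s => v s x) t + lap (v t) x
        = (ε : ℂ) * ((‖v t x‖ ^ 2 - 1 : ℝ) : ℂ) * v t x)
    (hloc : ∃ C > 0, ∃ γ > 0, ∀ k : ℕ, k ≤ 2 → ∀ (t : ℝ) (x : EuclideanSpace ℝ (Fin n)),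
      ‖iteratedFDeriv ℝ k (fun p : ℝ × EuclideanSpace ℝ (Fin n) => v p.1 p.2 - 1) (t, x)‖
        ≤ C * Real.exp (-γ * ‖x‖))
    (hper : ∃ T > 0, ∀ (t : ℝ) (x : EuclideanSpace ℝ (Fin n)), v (t + T) x = v t x)
    (hreg : (n = 1 ∧ ε * (energyNZcubic ε v - (ε / 2) * massNZ v) ≤ 0) ∨
            (n = 2 ∧ energyNZcubic ε v ≠ 0)) :
    ∀ t x, ‖v t x‖ = 1 := by
  have hv : Differentiable ℝ fun p : ℝ × EuclideanSpace ℝ (Fin n) => v p.1 p.2 - 1 :=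
    (hsmooth.differentiable (by simp)).sub_const 1
  have hGP := isLocalizedGP_of_solution hsmooth heq hloc
  rw [energyNZcubic_eq hv, massNZ_eq] at hreg
  obtain ⟨T, hT, hper⟩ := hper
  have hnorm := norm_sq_sub_one_eq (v := v)
  have hWper (t : ℝ) := fun x => virialDensity_periodic
    (α := fun p => (v p.1 p.2 - 1).re) (β := fun p => (v p.1 p.2 - 1).im) (T := T)
    (fun p => by simp [hper]) (fun p => by simp [hper]) (t, x)
  set α : ℝ × EuclideanSpace ℝ (Fin n) → ℝ := fun p => (v p.1 p.2 - 1).re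
  set β : ℝ × EuclideanSpace ℝ (Fin n) → ℝ := fun p => (v p.1 p.2 - 1).im
  set W : ℝ → ℝ := fun t => ∫ x, virialDensity α β (t, x) with hW
  have hWT (t : ℝ) : W (t + T) = W t := by
    simpa [hW] using congrArg (fun f => ∫ x, f x) (funext (hWper t))
  have hWd (t : ℝ) := hGP.hasDerivAt_virial t
  have hE (t : ℝ) : ∫ x, energyDensity ε α β (t, x) = ∫ x, energyDensity ε α β (0, x) :=
    is_const_of_deriv_eq_zero (fun t => (hGP.hasDerivAt_energy t).differentiableAt)
      (fun t => (hGP.hasDerivAt_energy t).deriv) t 0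
  have hM (t : ℝ) : ∫ x, massDensity α β (t, x) = ∫ x, massDensity α β (0, x) :=
    is_const_of_deriv_eq_zero (fun t => (hGP.hasDerivAt_mass t).differentiableAt)
      (fun t => (hGP.hasDerivAt_mass t).deriv) t 0
  rcases hreg with ⟨rfl, hreg⟩ | ⟨rfl, hreg⟩
  · set c : ℝ := ε * ((∫ x, energyDensity ε α β (0, x)) - ε / 2 * ∫ x, massDensity α β (0, x))
      with hc
    have hε2 : ε ^ 2 = 1 := by rcases hε with rfl | rfl <;> norm_num
    have hEi (t : ℝ) := hGP.rapidC1_energyDensity.integrable t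
    have hm2 (t : ℝ) : Integrable fun x => massDensity α β (t, x) ^ 2 := by
      simpa [sq] using (hGP.rapidC1_massDensity.mul hGP.rapidC1_massDensity).integrable t
    have hS (t : ℝ) : -(ε / 2) * ∫ x, virialSource ε α β (t, x)
        = 1 / 4 * (∫ x, massDensity α β (t, x) ^ 2) - c := by
      have h1 : ∫ x, virialSource ε α β (t, x) = 2 * (∫ x, energyDensity ε α β (t, x))
          - ε / 2 * (∫ x, massDensity α β (t, x) ^ 2) - ε * ∫ x, massDensity α β (t, x) := by
        rw [← integral_const_mul, ← integral_const_mul, ← integral_const_mul,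
          ← integral_sub, ← integral_sub]
        · refine integral_congr_ae (.of_forall fun x => ?_)
          simp [virialSource, energyDensity]
          ring
        · exact ((hEi t).const_mul _).sub ((hm2 t).const_mul _)
        · exact (hGP.rapidC1_massDensity.integrable t).const_mul _
        · exact (hEi t).const_mul _
        · exact (hm2 t).const_mul _
      rw [h1, hE, hM, hc]
      linear_combination (1 / 4 * ∫ x, massDensity α β (t, x) ^ 2) * hε2
    have hZd (t : ℝ) : HasDerivAt (fun t => -(ε / 2) * W t)
        (1 / 4 * (∫ x, massDensity α β (t, x) ^ 2) - c) t := by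
      rw [← hS]
      exact (hWd t).const_mul _
    have hnn (t : ℝ) : 0 ≤ ∫ x, massDensity α β (t, x) ^ 2 :=
      integral_nonneg fun x => sq_nonneg _
    have hmono : Monotone fun t => -(ε / 2) * W t :=
      monotone_of_deriv_nonneg (fun t => (hZd t).differentiableAt) fun t => by
        rw [(hZd t).deriv]
        linarith [hnn t]
    have hzero (t : ℝ) : 1 / 4 * (∫ x, massDensity α β (t, x) ^ 2) - c = 0 := by
      have hconst : (fun t => -(ε / 2) * W t) = fun _ => -(ε / 2) * W 0 :=
        funext fun t => hmono.eq_of_periodic (fun s => by simp [hWT s]) hT t 0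
      have := hZd t
      rw [hconst] at this
      exact this.unique (hasDerivAt_const _ _)
    intro t x
    have hint : ∫ x, massDensity α β (t, x) ^ 2 = 0 := by linarith [hzero t, hnn t]
    have hcont : Continuous fun x => massDensity α β (t, x) ^ 2 :=
      (hGP.rapidC1_massDensity.contDiff.continuous.comp (by fun_prop)).pow 2
    rw [integral_eq_zero_iff_of_nonneg (fun x => sq_nonneg _) (hm2 t)] at hint
    have h0 := congrFun ((hcont.ae_eq_iff_eq volume continuous_const).1 hint) x
    have h1 := hnorm t x
    rw [pow_eq_zero_iff two_ne_zero |>.1 h0] at h1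
    nlinarith [norm_nonneg (v t x)]
  · obtain ⟨t, -, ht⟩ := exists_hasDerivAt_eq_zero hT
      (fun t _ => (hWd t).continuousAt.continuousWithinAt) (by simpa using (hWT 0).symm)
      fun t _ => hWd t
    refine absurd ?_ hreg
    have hS : ∫ x, virialSource ε α β (t, x) = 2 * ∫ x, energyDensity ε α β (t, x) := by
      rw [← integral_const_mul]
      congr 1 with x
      simp [virialSource, energyDensity]
      ring
    rw [← hE t]
    linarith
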